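/- If f ~ N(μ, σ²) with σ > 0, then E[Φ(f)²] = Φ(μ/√(1+σ²)) − 2T(μ/√(1+σ²), 1/√(1+2σ²)). -/

import Mathlib

open MeasureTheory Real

/-- Standard normal density. -/
noncomputable def stdPdf (x : ℝ) : ℝ := (Real.sqrt (2 * Real.pi))⁻¹ * Real.exp (-x ^ 2 / 2)

/-- Standard normal CDF. -/
noncomputable def stdCdf (t : ℝ) : ℝ := ∫ s in Set.Iic t, stdPdf s

/-- Owen's T function. -/
noncomputable def owenT (h a : ℝ) : ℝ :=
  (2 * Real.pi)⁻¹ * ∫ x in (0:ℝ)..a, Real.exp (-h ^ 2 * (1 + x ^ 2) / 2) / (1 + x ^ 2)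

/-- Standard bivariate normal density with correlation ρ. -/
noncomputable def bvnPdf (ρ x y : ℝ) : ℝ :=
  Real.exp (-(x ^ 2 - 2 * ρ * x * y + y ^ 2) / (2 * (1 - ρ ^ 2))) /
    (2 * Real.pi * Real.sqrt (1 - ρ ^ 2))

/-- Standard bivariate normal CDF with correlation ρ. -/
noncomputable def bvn (u v ρ : ℝ) : ℝ :=
  ∫ p : ℝ × ℝ in Set.Iic u ×ˢ Set.Iic v, bvnPdf ρ p.1 p.2

/-- General bivariate Gaussian density with means μ₁ μ₂, std devs σ₁ σ₂, covariance σ₁₂. -/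
noncomputable def biGaussPdf (μ₁ μ₂ σ₁ σ₂ σ₁₂ x y : ℝ) : ℝ :=
  Real.exp (-(σ₂ ^ 2 * (x - μ₁) ^ 2 - 2 * σ₁₂ * (x - μ₁) * (y - μ₂) + σ₁ ^ 2 * (y - μ₂) ^ 2) /
      (2 * (σ₁ ^ 2 * σ₂ ^ 2 - σ₁₂ ^ 2))) /
    (2 * Real.pi * Real.sqrt (σ₁ ^ 2 * σ₂ ^ 2 - σ₁₂ ^ 2))

open Filter Topology ProbabilityTheory

lemma stdPdf_eq_gaussian : stdPdf = gaussianPDFReal 0 1 := by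
  funext x
  simp [stdPdf, gaussianPDFReal]

lemma stdPdf_continuous : Continuous stdPdf := by
  unfold stdPdf
  fun_prop

lemma stdPdf_integrable : Integrable stdPdf := by
  rw [stdPdf_eq_gaussian]
  exact integrable_gaussianPDFReal 0 1

lemma stdPdf_nonneg (x : ℝ) : 0 ≤ stdPdf x := by
  unfold stdPdf
  positivity

lemma stdPdf_le_one (x : ℝ) : stdPdf x ≤ 1 := by
  unfold stdPdf
  have h1 : (Real.sqrt (2 * Real.pi))⁻¹ ≤ 1 := by
    apply inv_le_one_of_one_le₀
    rw [Real.one_le_sqrt]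
    linarith [Real.pi_gt_three]
  have h2 : Real.exp (-x ^ 2 / 2) ≤ 1 := by
    rw [Real.exp_le_one_iff]
    nlinarith [sq_nonneg x]
  exact mul_le_one₀ h1 (Real.exp_pos _).le h2

lemma stdPdf_mul (x y : ℝ) :
    stdPdf x * stdPdf y = (2 * Real.pi)⁻¹ * Real.exp (-(x ^ 2 + y ^ 2) / 2) := by
  unfold stdPdf
  have h : (Real.sqrt (2 * Real.pi))⁻¹ * (Real.sqrt (2 * Real.pi))⁻¹ = (2 * Real.pi)⁻¹ := by
    rw [← mul_inv, Real.mul_self_sqrt (by positivity)]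
  rw [mul_mul_mul_comm, h, ← Real.exp_add]
  ring_nf

lemma stdCdf_eq_cdf (x : ℝ) : stdCdf x = cdf (gaussianReal 0 1) x := by
  rw [cdf_eq_real, Measure.real, gaussianReal_apply_eq_integral 0 one_ne_zero,
    ENNReal.toReal_ofReal, stdCdf, stdPdf_eq_gaussian]
  exact integral_nonneg (gaussianPDFReal_nonneg _ _)

lemma stdCdf_nonneg (x : ℝ) : 0 ≤ stdCdf x := by
  rw [stdCdf_eq_cdf]
  exact cdf_nonneg _ x

lemma stdCdf_le_one (x : ℝ) : stdCdf x ≤ 1 := by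
  rw [stdCdf_eq_cdf]
  exact cdf_le_one _ x

lemma stdCdf_tendsto : Tendsto stdCdf atBot (𝓝 0) := by
  have : stdCdf = cdf (gaussianReal 0 1) := funext stdCdf_eq_cdf
  rw [this]
  exact tendsto_cdf_atBot _

lemma stdCdf_hasDerivAt (x : ℝ) : HasDerivAt stdCdf (stdPdf x) x := by
  have h : stdCdf = fun t => (∫ s in (0:ℝ)..t, stdPdf s) + stdCdf 0 := by
    funext t
    have := intervalIntegral.integral_Iic_sub_Iic (μ := volume) (a := 0) (b := t)
      stdPdf_integrable.integrableOn stdPdf_integrable.integrableOn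
    rw [← this]
    simp [stdCdf]
  rw [h]
  exact (intervalIntegral.integral_hasDerivAt_right (stdPdf_continuous.intervalIntegrable _ _)
    (stdPdf_continuous.stronglyMeasurableAtFilter _ _) stdPdf_continuous.continuousAt).add_const _

lemma stdCdf_continuous : Continuous stdCdf :=
  continuous_iff_continuousAt.2 fun x => (stdCdf_hasDerivAt x).continuousAt

lemma stdCdf_zero : stdCdf 0 = 1 / 2 := by
  have h1 := integral_comp_neg_Iic 0 stdPdf
  have h2 := intervalIntegral.integral_Iic_add_Ioi (μ := volume) (b := (0:ℝ))
    stdPdf_integrable.integrableOn stdPdf_integrable.integrableOn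
  have h3 : ∀ x, stdPdf (-x) = stdPdf x := fun x => by simp [stdPdf]
  have h4 : ∫ x, stdPdf x = 1 := by
    rw [stdPdf_eq_gaussian]
    exact integral_gaussianPDFReal_eq_one 0 one_ne_zero
  simp only [h3, neg_zero] at h1
  rw [← h1, h4] at h2
  unfold stdCdf
  linarith

/-- Functions with equal derivatives and the same limit at minus infinity agree. -/
lemma eq_of_deriv_of_tendsto {f g d : ℝ → ℝ} (hf : ∀ x, HasDerivAt f (d x) x)
    (hg : ∀ x, HasDerivAt g (d x) x) (lf : Tendsto f atBot (𝓝 0))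
    (lg : Tendsto g atBot (𝓝 0)) (x : ℝ) : f x = g x := by
  have hd : ∀ y, HasDerivAt (fun y => f y - g y) 0 y := fun y => by
    simpa using (hf y).fun_sub (hg y)
  have hc : ∀ y, f y - g y = f x - g x := fun y =>
    is_const_of_deriv_eq_zero (fun z => (hd z).differentiableAt) (fun z => (hd z).deriv) y x
  have hl : Tendsto (fun y => f y - g y) atBot (𝓝 (0 - 0)) := lf.sub lg
  simp only [hc, sub_zero] at hl
  have := tendsto_nhds_unique tendsto_const_nhds hl
  linarith

lemma gauss_shift (g : ℝ → ℝ) (h c σ : ℝ) (hc : 0 < c) (hcs : c ^ 2 = 1 + σ ^ 2) :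
    ∫ z, g (c * h + σ * z) * stdPdf (c * h + σ * z) ∂(gaussianReal 0 1) =
      stdPdf h / c * ∫ w, g ((h + σ * w) / c) ∂(gaussianReal 0 1) := by
  rw [integral_gaussianReal_eq_integral_smul one_ne_zero,
    integral_gaussianReal_eq_integral_smul one_ne_zero, ← stdPdf_eq_gaussian]
  simp only [smul_eq_mul]
  set k : ℝ → ℝ := fun w => stdPdf w * g ((h + σ * w) / c) with hk
  have h1 : ∀ z, stdPdf z * (g (c * h + σ * z) * stdPdf (c * h + σ * z)) =
      stdPdf h * k (c * z + σ * h) := by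
    intro z
    have e1 : (h + σ * (c * z + σ * h)) / c = c * h + σ * z := by
      field_simp
      linear_combination (-h) * hcs
    have e2 : stdPdf z * stdPdf (c * h + σ * z) = stdPdf h * stdPdf (c * z + σ * h) := by
      rw [stdPdf_mul, stdPdf_mul]
      congr 3
      linear_combination (z ^ 2 - h ^ 2) * hcs
    simp only [hk, e1]
    linear_combination g (c * h + σ * z) * e2
  simp only [h1]
  rw [integral_const_mul]
  have h2 : ∫ z, k (c * z + σ * h) = |c⁻¹| • ∫ w, k (w + σ * h) :=
    Measure.integral_comp_mul_left (fun w => k (w + σ * h)) c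
  rw [h2, integral_add_right_eq_self k (σ * h), abs_of_pos (inv_pos.2 hc), smul_eq_mul]
  ring

lemma gauss_deriv (g g' : ℝ → ℝ) (B C : ℝ) (hg : ∀ x, HasDerivAt g (g' x) x)
    (hb : ∀ x, |g x| ≤ B) (hb' : ∀ x, |g' x| ≤ C) (hc' : Continuous g') (σ μ : ℝ) :
    HasDerivAt (fun m => ∫ z, g (m + σ * z) ∂(gaussianReal 0 1))
      (∫ z, g' (μ + σ * z) ∂(gaussianReal 0 1)) μ := by
  have hgc : Continuous g := continuous_iff_continuousAt.2 fun x => (hg x).continuousAt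
  refine (hasDerivAt_integral_of_dominated_loc_of_deriv_le (s := Set.univ)
    (F := fun m z => g (m + σ * z)) (F' := fun m z => g' (m + σ * z)) (bound := fun _ => C)
    univ_mem ?_ ?_ ?_ ?_ ?_ ?_).2
  · exact Eventually.of_forall fun m => (by fun_prop : Continuous _).aestronglyMeasurable
  · exact Integrable.of_bound (by fun_prop : Continuous _).aestronglyMeasurable B
      (Eventually.of_forall fun z => hb _)
  · exact (by fun_prop : Continuous _).aestronglyMeasurable
  · exact Eventually.of_forall fun z m _ => hb' _
  · exact integrable_const _
  · exact Eventually.of_forall fun z m _ => (hg _).comp_add_const m (σ * z)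

lemma gauss_tendsto (g : ℝ → ℝ) (B : ℝ) (hgc : Continuous g)
    (hb : ∀ x, |g x| ≤ B) (hl : Tendsto g atBot (𝓝 0)) (σ : ℝ) :
    Tendsto (fun m => ∫ z, g (m + σ * z) ∂(gaussianReal 0 1)) atBot (𝓝 0) := by
  have := tendsto_integral_filter_of_dominated_convergence (μ := gaussianReal 0 1)
    (l := atBot) (F := fun m z => g (m + σ * z)) (f := fun _ => (0:ℝ)) (fun _ => B)
    (Eventually.of_forall fun m => (by fun_prop : Continuous _).aestronglyMeasurable)
    (Eventually.of_forall fun m => Eventually.of_forall fun z => hb _)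
    (integrable_const _)
    (Eventually.of_forall fun z => hl.comp (tendsto_atBot_add_const_right _ _ tendsto_id))
  simpa using this

lemma abs_stdCdf (x : ℝ) : |stdCdf x| ≤ 1 := by
  rw [abs_of_nonneg (stdCdf_nonneg x)]
  exact stdCdf_le_one x

lemma abs_stdPdf (x : ℝ) : |stdPdf x| ≤ 1 := by
  rw [abs_of_nonneg (stdPdf_nonneg x)]
  exact stdPdf_le_one x

/-- The first-order identity: the expectation of the normal CDF. -/
lemma gauss_stdCdf (β α c : ℝ) (hc : 0 < c) (hcs : c ^ 2 = 1 + β ^ 2) :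
    ∫ z, stdCdf (α + β * z) ∂(gaussianReal 0 1) = stdCdf (α / c) := by
  refine eq_of_deriv_of_tendsto
    (f := fun α => ∫ z, stdCdf (α + β * z) ∂(gaussianReal 0 1))
    (g := fun α => stdCdf (α / c)) (d := fun α => stdPdf (α / c) / c) ?_ ?_ ?_ ?_ α
  · intro α
    have h1 := gauss_deriv stdCdf stdPdf 1 1 stdCdf_hasDerivAt abs_stdCdf abs_stdPdf
      stdPdf_continuous β α
    have h2 := gauss_shift (fun _ => 1) (α / c) c β hc hcs
    have e : c * (α / c) = α := by field_simp
    simp only [e, one_mul, integral_const, probReal_univ, smul_eq_mul, mul_one] at h2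
    rwa [h2] at h1
  · intro α
    have := (stdCdf_hasDerivAt (α / c)).comp α ((hasDerivAt_id α).div_const c)
    simpa [Function.comp_def, div_eq_mul_inv] using this
  · exact gauss_tendsto stdCdf 1 stdCdf_continuous abs_stdCdf stdCdf_tendsto β
  · exact stdCdf_tendsto.comp (tendsto_id.atBot_div_const hc)

lemma owenT_hasDerivAt (a h : ℝ) :
    HasDerivAt (fun h => owenT h a) (-(stdPdf h * (stdCdf (h * a) - 1 / 2))) h := by
  have key := (intervalIntegral.hasDerivAt_integral_of_dominated_loc_of_deriv_le
    (μ := volume) (a := 0) (b := a) (s := Metric.ball h 1) (x₀ := h)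
    (F := fun h x => Real.exp (-h ^ 2 * (1 + x ^ 2) / 2) / (1 + x ^ 2))
    (F' := fun h x => -h * Real.exp (-h ^ 2 * (1 + x ^ 2) / 2))
    (bound := fun _ => |h| + 1) (Metric.ball_mem_nhds h one_pos) ?_ ?_ ?_ ?_ ?_ ?_).2
  · have h3 : ∫ x in (0:ℝ)..a, h * stdPdf (h * x) = stdCdf (h * a) - stdCdf (h * 0) := by
      refine intervalIntegral.integral_eq_sub_of_hasDerivAt
        (f := fun x => stdCdf (h * x)) (fun x _ => ?_) ?_
      · have := (stdCdf_hasDerivAt (h * x)).comp x ((hasDerivAt_id x).const_mul h)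
        simpa [Function.comp_def, mul_comm] using this
      · have := stdPdf_continuous
        exact (by fun_prop : Continuous _).intervalIntegrable _ _
    rw [mul_zero, stdCdf_zero] at h3
    have h4 := key.const_mul (2 * Real.pi)⁻¹
    unfold owenT
    convert! h4 using 1
    rw [← h3, ← intervalIntegral.integral_const_mul, ← intervalIntegral.integral_const_mul,
      ← intervalIntegral.integral_neg]
    refine intervalIntegral.integral_congr fun x _ => ?_
    have h5 := stdPdf_mul h (h * x)
    have h6 : -(h ^ 2 + (h * x) ^ 2) / 2 = -h ^ 2 * (1 + x ^ 2) / 2 := by ring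
    rw [h6] at h5
    linear_combination (-h) * h5
  · refine Eventually.of_forall fun m => Continuous.aestronglyMeasurable ?_
    exact Continuous.div (by fun_prop) (by fun_prop) (fun x => by positivity)
  · refine Continuous.intervalIntegrable ?_ _ _
    exact Continuous.div (by fun_prop) (by fun_prop) (fun x => by positivity)
  · exact (by fun_prop : Continuous _).aestronglyMeasurable
  · refine Eventually.of_forall fun x _ m hm => ?_
    rw [Real.norm_eq_abs, abs_mul, abs_neg, abs_of_pos (Real.exp_pos _)]
    have h1 : Real.exp (-m ^ 2 * (1 + x ^ 2) / 2) ≤ 1 := by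
      rw [Real.exp_le_one_iff]
      have : 0 ≤ m ^ 2 * (1 + x ^ 2) := by positivity
      linarith
    have h2 : |m| ≤ |h| + 1 := by
      rw [Metric.mem_ball, Real.dist_eq] at hm
      have := abs_sub_abs_le_abs_sub m h
      linarith
    calc |m| * _ ≤ |m| * 1 := by gcongr
      _ ≤ _ := by linarith
  · exact intervalIntegrable_const
  · refine Eventually.of_forall fun x _ m _ => ?_
    have hx : (1 + x ^ 2) ≠ 0 := by positivity
    have h1 : HasDerivAt (fun m : ℝ => -m ^ 2 * (1 + x ^ 2) / 2)
        (-(2 * m) * (1 + x ^ 2) / 2) m := by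
      have := (((hasDerivAt_pow 2 m).fun_neg).mul_const (1 + x ^ 2)).div_const 2
      simpa using this
    convert! (h1.exp).div_const (1 + x ^ 2) using 1
    field_simp

lemma owenT_tendsto (a : ℝ) : Tendsto (fun h => owenT h a) atBot (𝓝 0) := by
  have hb : ∀ h, ‖owenT h a‖ ≤ (2 * Real.pi)⁻¹ * (Real.exp (-h ^ 2 / 2) * |a - 0|) := by
    intro h
    unfold owenT
    rw [norm_mul, Real.norm_of_nonneg (by positivity : (0:ℝ) ≤ (2 * Real.pi)⁻¹)]
    gcongr
    refine intervalIntegral.norm_integral_le_of_norm_le_const fun x _ => ?_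
    rw [Real.norm_of_nonneg (by positivity)]
    have h0 : 0 ≤ x ^ 2 := sq_nonneg x
    refine (div_le_self (Real.exp_pos _).le (by linarith)).trans ?_
    apply Real.exp_le_exp.2
    nlinarith [mul_nonneg (sq_nonneg h) h0]
  refine squeeze_zero_norm hb ?_
  have h1 : Tendsto (fun h : ℝ => -h ^ 2 / 2) atBot atBot := by
    have h2 : Tendsto (fun h : ℝ => h ^ 2) atBot atTop := by
      have h4 := (tendsto_pow_atTop (α := ℝ) two_ne_zero).comp tendsto_neg_atBot_atTop
      simpa [Function.comp_def] using h4
    exact (tendsto_neg_atTop_atBot.comp h2).atBot_div_const two_pos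
  have h3 := ((Real.tendsto_exp_atBot.comp h1).mul_const |a - 0|).const_mul (2 * Real.pi)⁻¹
  simpa using h3

lemma gauss_stdCdf_sq (μ σ : ℝ) :
    ∫ z, stdCdf (μ + σ * z) ^ 2 ∂(gaussianReal 0 1) =
      stdCdf (μ / Real.sqrt (1 + σ ^ 2)) -
        2 * owenT (μ / Real.sqrt (1 + σ ^ 2)) (1 / Real.sqrt (1 + 2 * σ ^ 2)) := by
  set c := Real.sqrt (1 + σ ^ 2) with hcdef
  set r := Real.sqrt (1 + 2 * σ ^ 2) with hrdef
  have hc : 0 < c := Real.sqrt_pos.2 (by positivity)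
  have hr : 0 < r := Real.sqrt_pos.2 (by positivity)
  have hcs : c ^ 2 = 1 + σ ^ 2 := Real.sq_sqrt (by positivity)
  have hrs : r ^ 2 = 1 + 2 * σ ^ 2 := Real.sq_sqrt (by positivity)
  refine eq_of_deriv_of_tendsto
    (f := fun μ => ∫ z, stdCdf (μ + σ * z) ^ 2 ∂(gaussianReal 0 1))
    (g := fun μ => stdCdf (μ / c) - 2 * owenT (μ / c) (1 / r))
    (d := fun μ => stdPdf (μ / c) / c * (2 * stdCdf (μ / c * (1 / r)))) ?_ ?_ ?_ ?_ μ
  · intro μ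
    have h1 := gauss_deriv (fun x => stdCdf x ^ 2) (fun x => 2 * stdCdf x * stdPdf x) 1 2
      (fun x => by simpa using (stdCdf_hasDerivAt x).fun_pow 2)
      (fun x => by
        rw [abs_pow]
        exact pow_le_one₀ (abs_nonneg _) (abs_stdCdf x))
      (fun x => by
        rw [abs_mul, abs_mul, abs_two]
        nlinarith [abs_stdCdf x, abs_stdPdf x, abs_nonneg (stdCdf x), abs_nonneg (stdPdf x)])
      (by have := stdCdf_continuous; have := stdPdf_continuous; fun_prop) σ μ
    have h2 := gauss_shift (fun x => 2 * stdCdf x) (μ / c) c σ hc hcs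
    have e : c * (μ / c) = μ := by field_simp
    have h3 := gauss_stdCdf (σ / c) (μ / c / c) (r / c) (by positivity) (by
      rw [div_pow, div_pow, hrs]
      field_simp
      linarith)
    have h4 : ∀ w, (μ / c + σ * w) / c = μ / c / c + σ / c * w := fun w => by ring
    have h5 : μ / c / c / (r / c) = μ / c * (1 / r) := by field_simp
    simp only [e, h4] at h2
    rw [integral_const_mul, h3, h5] at h2
    rwa [h2] at h1
  · intro μ
    have hd : HasDerivAt (fun μ : ℝ => μ / c) (1 / c) μ := (hasDerivAt_id μ).div_const c
    have h1 := (stdCdf_hasDerivAt (μ / c)).comp μ hd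
    have h2 := ((owenT_hasDerivAt (1 / r) (μ / c)).comp μ hd).const_mul 2
    convert! h1.sub h2 using 1
    ring
  · refine gauss_tendsto (fun x => stdCdf x ^ 2) 1 (stdCdf_continuous.pow 2) (fun x => ?_) ?_ σ
    · rw [abs_pow]
      exact pow_le_one₀ (abs_nonneg _) (abs_stdCdf x)
    · simpa using stdCdf_tendsto.pow 2
  · have hd : Tendsto (fun μ : ℝ => μ / c) atBot atBot := tendsto_id.atBot_div_const hc
    have := (stdCdf_tendsto.comp hd).sub (((owenT_tendsto (1 / r)).comp hd).const_mul 2)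
    simpa [Function.comp_def] using this

theorem stmt_5 (μ σ : ℝ) (hσ : 0 < σ) :
    ∫ x, stdCdf x ^ 2 ∂(ProbabilityTheory.gaussianReal μ ⟨σ ^ 2, sq_nonneg σ⟩) =
      stdCdf (μ / Real.sqrt (1 + σ ^ 2)) -
        2 * owenT (μ / Real.sqrt (1 + σ ^ 2)) (1 / Real.sqrt (1 + 2 * σ ^ 2)) := by
  have h : gaussianReal μ ⟨σ ^ 2, sq_nonneg σ⟩ =
      (gaussianReal 0 1).map (fun z => μ + σ * z) := by
    have h1 : (fun z : ℝ => μ + σ * z) = (fun x => μ + x) ∘ (fun z => σ * z) := rfl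
    rw [h1, ← Measure.map_map (by fun_prop) (by fun_prop), gaussianReal_map_const_mul,
      gaussianReal_map_const_add]
    simp
    rfl
  have hm := stdCdf_continuous
  rw [h, integral_map (by fun_prop) (by fun_prop : Continuous _).aestronglyMeasurable]
  exact gauss_stdCdf_sq μ σ
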